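/- arXiv:1506.02435 — 2 statements merged into one kernel-verified Lean document; each statement's English description precedes it below -/
import Mathlib

section
/- Let Γ be an n-vertex connected nonregular finite simple graph whose adjacency matrix has exactly three distinct eigenvalues s > 1 > −t, which is not a cone (no vertex of degree n−1) and not biregular (has at least three distinct vertex degrees). Then every vertex x of Γ satisfies α_x := √(d_x − t) ≤ t + 1; equivalently, d_x ≤ t² + 3t + 1. -/
open Matrix in
/-- A real symmetric matrix is annihilated by the product of linear factors over its spectrum. -/
theorem Matrix.IsHermitian.mul_sub_eq_zero_of_spectrum_subset {V : Type*} [Fintype V]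
    [DecidableEq V] {A : Matrix V V ℝ} (hA : A.IsHermitian) {a b c : ℝ}
    (hspec : spectrum ℝ A ⊆ {a, b, c}) :
    (A - a • 1) * ((A - b • 1) * (A - c • 1)) = 0 := by
  apply Matrix.toLin'.injective
  rw [map_zero]
  refine (hA.eigenvectorBasis.toBasis.map
    (WithLp.linearEquiv 2 ℝ (V → ℝ))).ext fun j => ?_
  have hj := hA.mulVec_eigenvectorBasis j
  have hmem : hA.eigenvalues j ∈ ({a, b, c} : Set ℝ) := hspec (hA.eigenvalues_mem_spectrum_real j)
  set w : V → ℝ := ⇑(hA.eigenvectorBasis j)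
  have key (x : ℝ) : (A - x • 1) *ᵥ w = (hA.eigenvalues j - x) • w := by
    rw [sub_mulVec, hj, smul_mulVec, one_mulVec, sub_smul]
  suffices ((A - a • 1) * ((A - b • 1) * (A - c • 1))) *ᵥ w = 0 by
    simp only [Module.Basis.map_apply, OrthonormalBasis.coe_toBasis, toLin'_apply,
      LinearMap.zero_apply]
    exact this
  rw [← mulVec_mulVec, ← mulVec_mulVec, key, mulVec_smul, key, mulVec_smul, mulVec_smul, key,
    smul_smul, smul_smul]
  rcases hmem with h | h | (h : _ = _) <;> simp [h]

open Matrix in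
/-- `s - A` is positive semidefinite as soon as `s` bounds the spectrum of `A`. -/
theorem Matrix.IsHermitian.posSemidef_smul_one_sub {V : Type*} [Fintype V]
    [DecidableEq V] {A : Matrix V V ℝ} (hA : A.IsHermitian) {s : ℝ}
    (hspec : ∀ x ∈ spectrum ℝ A, x ≤ s) : (s • 1 - A).PosSemidef := by
  rw [Matrix.posSemidef_iff_isHermitian_and_spectrum_nonneg]
  refine ⟨?_, ?_⟩
  · refine IsHermitian.sub ?_ hA
    simp [IsHermitian]
  · intro x hx
    have : s • (1 : Matrix V V ℝ) = algebraMap ℝ (Matrix V V ℝ) s := by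
      rw [Algebra.algebraMap_eq_smul_one]
    rw [this, ← spectrum.singleton_sub_eq] at hx
    obtain ⟨_, rfl, y, hy, rfl⟩ := hx
    exact sub_nonneg.2 (hspec y hy)

namespace SimpleGraph

open Matrix

/-- A nonnegative eigenvector of a connected graph with a zero entry vanishes. -/
theorem Connected.eq_zero_of_nonneg_of_adjMatrix_mulVec {V : Type*} [Fintype V]
    {Γ : SimpleGraph V} [DecidableRel Γ.Adj]
    (hconn : Γ.Connected) {s : ℝ} {w : V → ℝ} (hw : Γ.adjMatrix ℝ *ᵥ w = s • w)
    (h0 : ∀ v, 0 ≤ w v) {u : V} (hu : w u = 0) : w = 0 := by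
  have step (x y : V) (hxy : Γ.Adj x y) (hx : w x = 0) : w y = 0 := by
    have h := congrFun hw x
    rw [adjMatrix_mulVec_apply, Pi.smul_apply, hx, smul_zero,
      Finset.sum_eq_zero_iff_of_nonneg fun v _ => h0 v] at h
    exact h y (by simpa using hxy)
  have walk (x y : V) (p : Γ.Walk x y) : w x = 0 → w y = 0 := by
    induction p with
    | nil => exact id
    | cons h _ ih => exact fun hx => ih (step _ _ h hx)
  funext v
  exact walk u v (hconn.preconnected u v).some hu

variable {V : Type*} [Fintype V] [DecidableEq V] (Γ : SimpleGraph V) [DecidableRel Γ.Adj]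

/-- Taking absolute values preserves eigenvectors for the largest eigenvalue. -/
theorem adjMatrix_mulVec_abs {s : ℝ} (hspec : ∀ x ∈ spectrum ℝ (Γ.adjMatrix ℝ), x ≤ s)
    {w : V → ℝ} (hw : Γ.adjMatrix ℝ *ᵥ w = s • w) : Γ.adjMatrix ℝ *ᵥ |w| = s • |w| := by
  have hA : (Γ.adjMatrix ℝ).IsHermitian := by
    rw [IsHermitian, conjTranspose_eq_transpose_of_trivial, transpose_adjMatrix]
  have hpsd := hA.posSemidef_smul_one_sub hspec
  have expand (x : V → ℝ) : (s • 1 - Γ.adjMatrix ℝ) *ᵥ x = s • x - Γ.adjMatrix ℝ *ᵥ x := by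
    rw [sub_mulVec, smul_mulVec, one_mulVec]
  have hnn : 0 ≤ |w| ⬝ᵥ ((s • 1 - Γ.adjMatrix ℝ) *ᵥ |w|) := by
    simpa using hpsd.dotProduct_mulVec_nonneg |w|
  have hle : w ⬝ᵥ (Γ.adjMatrix ℝ *ᵥ w) ≤ |w| ⬝ᵥ (Γ.adjMatrix ℝ *ᵥ |w|) := by
    simp only [dotProduct, adjMatrix_mulVec_apply, Finset.mul_sum]
    refine Finset.sum_le_sum fun i _ => Finset.sum_le_sum fun j _ => ?_
    rw [Pi.abs_apply, Pi.abs_apply, ← abs_mul]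
    exact le_abs_self _
  have hsq : |w| ⬝ᵥ |w| = w ⬝ᵥ w := by simp [dotProduct]
  have hzero : |w| ⬝ᵥ ((s • 1 - Γ.adjMatrix ℝ) *ᵥ |w|) = 0 := by
    refine le_antisymm ?_ hnn
    rw [expand, dotProduct_sub, dotProduct_smul, hsq]
    rw [hw, dotProduct_smul] at hle
    linarith
  have hker := (hpsd.dotProduct_mulVec_zero_iff |w|).1 (by simpa using hzero)
  rw [expand] at hker
  exact (sub_eq_zero.1 hker).symm

/-- Perron–Frobenius for connected graphs: the largest eigenvalue is simple and has a positive
eigenvector. -/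
theorem Connected.exists_pos_adjMatrix_mulVec {Γ : SimpleGraph V} [DecidableRel Γ.Adj]
    (hconn : Γ.Connected) {s : ℝ} (hs : s ∈ spectrum ℝ (Γ.adjMatrix ℝ))
    (hspec : ∀ x ∈ spectrum ℝ (Γ.adjMatrix ℝ), x ≤ s) :
    ∃ p : V → ℝ, (∀ v, 0 < p v) ∧ Γ.adjMatrix ℝ *ᵥ p = s • p ∧
      ∀ w, Γ.adjMatrix ℝ *ᵥ w = s • w → ∃ k : ℝ, w = k • p := by
  have nowhere (w : V → ℝ) (hw : Γ.adjMatrix ℝ *ᵥ w = s • w) (u : V) (hu : w u = 0) : w = 0 := by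
    have h := hconn.eq_zero_of_nonneg_of_adjMatrix_mulVec
      (Γ.adjMatrix_mulVec_abs hspec hw) (abs_nonneg w) (u := u) (by simp [hu])
    funext v
    exact abs_eq_zero.1 (congrFun h v)
  obtain ⟨w, hw, hw0⟩ : ∃ w : V → ℝ, Γ.adjMatrix ℝ *ᵥ w = s • w ∧ w ≠ 0 := by
    rw [← Matrix.spectrum_toLin', ← Module.End.hasEigenvalue_iff_mem_spectrum] at hs
    obtain ⟨w, hw⟩ := hs.exists_hasEigenvector
    exact ⟨w, by simpa using hw.apply_eq_smul, hw.2⟩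
  have hp := Γ.adjMatrix_mulVec_abs hspec hw
  have hpos (v : V) : 0 < |w| v := abs_pos.2 fun h => hw0 (nowhere w hw v h)
  refine ⟨|w|, hpos, hp, fun w' hw' => ?_⟩
  obtain ⟨u⟩ := hconn.nonempty
  refine ⟨w' u / |w| u, sub_eq_zero.1 (nowhere _ ?_ u ?_)⟩
  · rw [mulVec_sub, mulVec_smul, hw', hp, smul_sub, smul_comm]
  · rw [Pi.sub_apply, Pi.smul_apply, smul_eq_mul, div_mul_cancel₀ _ (hpos u).ne', sub_self]

/-- A connected graph with spectrum `{s, 1, -t}` satisfies `(A - 1)(A + t) = α αᵀ` for some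
positive vector `α`. -/
theorem Connected.exists_pos_vecMulVec {Γ : SimpleGraph V} [DecidableRel Γ.Adj]
    (hconn : Γ.Connected) {s t : ℝ} (hs : 1 < s) (ht : -t < 1)
    (hspec : spectrum ℝ (Γ.adjMatrix ℝ) = {s, 1, -t}) :
    ∃ α : V → ℝ, (∀ v, 0 < α v) ∧
      (Γ.adjMatrix ℝ - (1 : ℝ) • 1) * (Γ.adjMatrix ℝ - (-t) • 1) = vecMulVec α α := by
  have hA : (Γ.adjMatrix ℝ).IsHermitian := by
    rw [IsHermitian, conjTranspose_eq_transpose_of_trivial, transpose_adjMatrix]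
  obtain ⟨p, hpos, hp, huniq⟩ := hconn.exists_pos_adjMatrix_mulVec (s := s) (by simp [hspec])
    (by rw [hspec]; rintro x (rfl | rfl | rfl) <;> linarith)
  have hann := hA.mul_sub_eq_zero_of_spectrum_subset hspec.subset
  set A := Γ.adjMatrix ℝ
  set M := (A - (1 : ℝ) • 1) * (A - (-t) • 1) with hM
  have hAT : Aᵀ = A := transpose_adjMatrix _
  have hMT (i j : V) : M i j = M j i := by
    have : Mᵀ = M := by
      rw [hM, transpose_mul, transpose_sub, transpose_sub, hAT]
      simp only [transpose_smul, transpose_one]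
      simp only [sub_mul, mul_sub, smul_mul_assoc, mul_smul_comm, one_mul, mul_one]
      module
    exact congrFun (congrFun this j) i
  have hcol (j : V) : ∃ k : ℝ, M.col j = k • p := by
    apply huniq
    rw [← mulVec_single_one, mulVec_mulVec, ← sub_eq_zero, ← smul_mulVec, ← sub_mulVec]
    have : A * M - s • M = 0 := by rw [← hann, sub_mul, smul_mul_assoc, one_mul]
    rw [this, zero_mulVec]
  choose k hk using hcol
  have hMk (i j : V) : M i j = k j * p i := congrFun (hk j) i
  obtain ⟨u⟩ := hconn.nonempty
  set c := k u / p u with hc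
  have hkc (j : V) : k j = c * p j := by
    have h := hMT u j
    rw [hMk, hMk] at h
    rw [hc]
    have := (hpos u).ne'
    field_simp
    exact h
  have hMp : M *ᵥ p = ((s - 1) * (s + t)) • p := by
    have key (x : ℝ) : (A - x • 1) *ᵥ p = (s - x) • p := by
      rw [sub_mulVec, hp, smul_mulVec, one_mulVec, sub_smul]
    rw [hM, ← mulVec_mulVec, key, mulVec_smul, key, smul_smul]
    congr 1
    ring
  have hcpos : 0 < c := by
    have h := congrFun hMp u
    simp only [mulVec, dotProduct, hMk, hkc, Pi.smul_apply, smul_eq_mul] at h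
    have h2 : ∑ x, c * p x * p u * p x = c * ((∑ x, p x * p x) * p u) := by
      rw [Finset.sum_mul, Finset.mul_sum]
      exact Finset.sum_congr rfl fun x _ => by ring
    rw [h2] at h
    have h3 : 0 < (s - 1) * (s + t) * p u :=
      mul_pos (mul_pos (by linarith) (by linarith)) (hpos u)
    rw [← h] at h3
    exact pos_of_mul_pos_left h3
      (mul_nonneg (Finset.sum_nonneg fun x _ => mul_self_nonneg _) (hpos u).le)
  refine ⟨fun v => √c * p v, fun v => mul_pos (Real.sqrt_pos.2 hcpos) (hpos v), ?_⟩
  ext i j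
  rw [hMk, hkc, vecMulVec_apply]
  linear_combination (-(p i * p j)) * Real.mul_self_sqrt hcpos.le

/-- `α` is the positive vector with `(A - 1)(A + t) = α αᵀ`, expressed through degrees and
numbers of common neighbors. -/
structure IsValencyVector (t : ℝ) (α : V → ℝ) : Prop where
  pos (v : V) : 0 < α v
  sq (v : V) : α v ^ 2 = Γ.degree v - t
  of_not_adj {u v : V} : u ≠ v → ¬ Γ.Adj u v →
    α u * α v = (Γ.neighborFinset u ∩ Γ.neighborFinset v).card
  of_adj {u v : V} : Γ.Adj u v →
    α u * α v = (Γ.neighborFinset u ∩ Γ.neighborFinset v).card + t - 1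

theorem adjMatrix_mul_self_apply (u v : V) :
    (Γ.adjMatrix ℝ * Γ.adjMatrix ℝ) u v = (Γ.neighborFinset u ∩ Γ.neighborFinset v).card := by
  rw [adjMatrix_mul_apply]
  simp only [adjMatrix_apply, Finset.sum_boole]
  congr 2
  ext w
  simp [adj_comm]

theorem Connected.exists_isValencyVector {Γ : SimpleGraph V} [DecidableRel Γ.Adj]
    (hconn : Γ.Connected) {s t : ℝ} (hs : 1 < s) (ht : -t < 1)
    (hspec : spectrum ℝ (Γ.adjMatrix ℝ) = {s, 1, -t}) :
    ∃ α : V → ℝ, Γ.IsValencyVector t α := by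
  obtain ⟨α, hpos, hα⟩ := hconn.exists_pos_vecMulVec hs ht hspec
  have entry (u v : V) : α u * α v = (Γ.neighborFinset u ∩ Γ.neighborFinset v).card
      + (t - 1) * Γ.adjMatrix ℝ u v - t * (1 : Matrix V V ℝ) u v := by
    rw [← vecMulVec_apply, ← hα, ← adjMatrix_mul_self_apply]
    simp only [sub_mul, mul_sub, smul_mul_assoc, mul_smul_comm, one_mul, mul_one,
      Matrix.sub_apply, Matrix.smul_apply, smul_eq_mul]
    ring
  refine ⟨α, hpos, fun v => ?_, fun {u v} huv h => ?_, fun {u v} h => ?_⟩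
  · rw [sq, entry]
    simp
  · rw [entry]
    simp [h, one_apply_ne huv]
  · rw [entry]
    simp [h, one_apply_ne h.ne]
    ring

theorem card_inter_neighborFinset_le_degree (u v : V) :
    (Γ.neighborFinset u ∩ Γ.neighborFinset v).card ≤ Γ.degree v :=
  Finset.card_le_card Finset.inter_subset_right

theorem Adj.card_inter_neighborFinset_lt_degree {Γ : SimpleGraph V} [DecidableRel Γ.Adj] {u v : V}
    (h : Γ.Adj u v) : (Γ.neighborFinset u ∩ Γ.neighborFinset v).card + 1 ≤ Γ.degree v := by
  refine Finset.card_lt_card (Finset.ssubset_iff_of_subset Finset.inter_subset_right |>.2 ⟨u, ?_⟩)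
  simp [h.symm]

theorem exists_not_adj_of_degree_ne {v : V} (h : Γ.degree v ≠ Fintype.card V - 1) :
    ∃ y, v ≠ y ∧ ¬ Γ.Adj v y := by
  by_contra! hall
  refine h ?_
  rw [← card_neighborFinset_eq_degree, ← Finset.card_univ,
    ← Finset.card_erase_of_mem (Finset.mem_univ v)]
  congr 1
  ext y
  simp only [mem_neighborFinset, Finset.mem_erase, Finset.mem_univ, and_true]
  exact ⟨fun hy => hy.ne', fun hy => hall y hy.symm⟩

namespace IsValencyVector

variable {Γ} {t : ℝ} {α : V → ℝ}

theorem mul_le_of_not_adj (h : Γ.IsValencyVector t α) {u v : V} (huv : u ≠ v) (hn : ¬ Γ.Adj u v) :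
    α u * α v ≤ α v ^ 2 + t := by
  rw [h.of_not_adj huv hn, h.sq, sub_add_cancel]
  exact_mod_cast Γ.card_inter_neighborFinset_le_degree u v

theorem mul_le_of_adj (h : Γ.IsValencyVector t α)
    {u v : V} (huv : Γ.Adj u v) : α u * α v ≤ α v ^ 2 + 2 * t - 2 := by
  have := huv.card_inter_neighborFinset_lt_degree
  have : ((Γ.neighborFinset u ∩ Γ.neighborFinset v).card : ℝ) + 1 ≤ Γ.degree v := by
    exact_mod_cast this
  rw [h.of_adj huv, h.sq]
  linarith

theorem degree_eq_iff (h : Γ.IsValencyVector t α)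
    {u v : V} : Γ.degree u = Γ.degree v ↔ α u = α v := by
  rw [← sq_eq_sq₀ (h.pos u).le (h.pos v).le, h.sq, h.sq, sub_left_inj, Nat.cast_inj]

theorem one_lt (h : Γ.IsValencyVector t α)
    (hconn : Γ.Connected) (hnonreg : ¬ ∃ k, Γ.IsRegularOfDegree k) : 1 < t := by
  by_contra! ht
  have hle {x y : V} (hxy : Γ.Adj x y) : α x ≤ α y := by
    have := h.mul_le_of_adj hxy
    nlinarith [h.pos y]
  have walk (x y : V) (p : Γ.Walk x y) : α x = α y := by
    induction p with
    | nil => rfl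
    | cons hxy _ ih => exact (le_antisymm (hle hxy) (hle hxy.symm)).trans ih
  obtain ⟨u⟩ := hconn.nonempty
  exact hnonreg ⟨Γ.degree u, fun v => h.degree_eq_iff.2 (walk v u (hconn.preconnected v u).some)⟩

theorem exists_int_eq (h : Γ.IsValencyVector t α)
    (ht : 1 < t) (v : V) (hv : Γ.degree v ≠ Fintype.card V - 1) :
    ∃ m : ℤ, t = m := by
  obtain ⟨y, hvy, hn⟩ := Γ.exists_not_adj_of_degree_ne hv
  have hdeg (w : V) : t < Γ.degree w := by
    have := pow_pos (h.pos w) 2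
    rw [h.sq] at this
    linarith
  obtain ⟨z, hz⟩ : ∃ z, Γ.Adj v z := by
    refine (Γ.degree_pos_iff_exists_adj v).1 ?_
    exact_mod_cast (zero_lt_one.trans ht).trans (hdeg v)
  have hsq (u w : V) : (α u * α w) ^ 2 = (Γ.degree u - t) * (Γ.degree w - t) := by
    rw [mul_pow, h.sq, h.sq]
  have h1 := hsq v y
  have h2 := hsq v z
  rw [h.of_not_adj hvy hn] at h1
  rw [h.of_adj hz] at h2
  set c := (Γ.neighborFinset v ∩ Γ.neighborFinset y).card
  set c' := (Γ.neighborFinset v ∩ Γ.neighborFinset z).card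
  obtain ⟨q, rfl⟩ : ∃ q : ℚ, t = q := by
    refine ⟨(Γ.degree v * Γ.degree z - (c' - 1) ^ 2) / (Γ.degree v + Γ.degree z + 2 * c' - 2), ?_⟩
    push_cast
    rw [eq_div_iff]
    · linarith
    · have := hdeg v
      have := hdeg z
      have : (0 : ℝ) ≤ c' := Nat.cast_nonneg _
      linarith
  have hint : IsIntegral ℤ q := by
    refine ⟨.X ^ 2 + .C (-(Γ.degree v + Γ.degree y : ℤ)) * .X +
      .C (Γ.degree v * Γ.degree y - c ^ 2 : ℤ), by monicity!, ?_⟩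
    have h3 : (c : ℚ) ^ 2 = (Γ.degree v - q) * (Γ.degree y - q) := by exact_mod_cast h1
    simp only [Polynomial.eval₂_add, Polynomial.eval₂_mul, Polynomial.eval₂_pow,
      Polynomial.eval₂_X, Polynomial.eval₂_C]
    simp
    linarith
  obtain ⟨m, hm⟩ := IsIntegrallyClosed.isIntegral_iff.1 hint
  exact ⟨m, by rw [← hm]; simp⟩

/-- If `t` is an integer, all products `α u * α v` are integers. -/
theorem exists_int_mul_eq (h : Γ.IsValencyVector t α)
    {m : ℤ} (hm : t = m) (u v : V) : ∃ k : ℤ, α u * α v = k := by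
  by_cases huv : u = v
  · subst huv
    exact ⟨Γ.degree u - m, by rw [← pow_two, h.sq, hm]; push_cast; rfl⟩
  by_cases hadj : Γ.Adj u v
  · exact ⟨(Γ.neighborFinset u ∩ Γ.neighborFinset v).card + m - 1, by
      rw [h.of_adj hadj, hm]; push_cast; ring⟩
  · exact ⟨(Γ.neighborFinset u ∩ Γ.neighborFinset v).card, by
      rw [h.of_not_adj huv hadj]; push_cast; ring⟩

/-- If `t` is an integer, two entries at distance less than one coincide. -/
theorem eq_of_abs_sub_lt_one (h : Γ.IsValencyVector t α)
    {m : ℤ} (hm : t = m) {u v : V} (huv : |α u - α v| < 1) :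
    α u = α v := by
  obtain ⟨a, ha⟩ := h.exists_int_mul_eq hm u u
  obtain ⟨b, hb⟩ := h.exists_int_mul_eq hm u v
  obtain ⟨c, hc⟩ := h.exists_int_mul_eq hm v v
  have hsq : (α u - α v) ^ 2 = (a - 2 * b + c : ℤ) := by
    push_cast
    rw [← ha, ← hb, ← hc]
    ring
  have hlt : (α u - α v) ^ 2 < 1 := (sq_lt_one_iff_abs_lt_one _).2 huv
  have hnn := sq_nonneg (α u - α v)
  rw [hsq] at hlt hnn
  have hz : a - 2 * b + c = 0 := by
    have h1 : a - 2 * b + c < 1 := by exact_mod_cast hlt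
    have h2 : 0 ≤ a - 2 * b + c := by exact_mod_cast hnn
    omega
  rw [hz, Int.cast_zero] at hsq
  exact sub_eq_zero.1 (pow_eq_zero_iff two_ne_zero |>.1 hsq)

theorem one_le (h : Γ.IsValencyVector t α) {m : ℤ} (hm : t = m) (v : V) : 1 ≤ α v := by
  obtain ⟨a, ha⟩ := h.exists_int_mul_eq hm v v
  have hpos := mul_pos (h.pos v) (h.pos v)
  rw [ha] at hpos
  have h1 : (1 : ℝ) ≤ a := by exact_mod_cast Int.add_one_le_iff.2 (Int.cast_pos.1 hpos)
  nlinarith [h.pos v]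

/-- A vertex whose entry is maximal and exceeds `t + 1` shares its entry with all its
non-neighbors. -/
theorem eq_of_not_adj (h : Γ.IsValencyVector t α) {m : ℤ} (hm : t = m) {x y : V} (hmax : α y ≤ α x)
    (hx : t + 1 < α x) (hxy : ¬ Γ.Adj x y) : α y = α x := by
  by_cases hne : x = y
  · rw [hne]
  refine h.eq_of_abs_sub_lt_one hm ?_
  rw [abs_sub_lt_iff]
  refine ⟨by linarith, ?_⟩
  by_contra! hge
  have h1 := h.mul_le_of_not_adj hne hxy
  nlinarith [h.one_le hm y]

/-- Around a vertex whose entry is maximal and exceeds `t + 1`, an entry at least two differs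
from the maximum by less than two. -/
theorem sub_lt_two (h : Γ.IsValencyVector t α) {m : ℤ} (hm : t = m) {x y : V} (hmax : α y ≤ α x)
    (hx : t + 1 < α x) (hy : 2 ≤ α y) : α x - α y < 2 := by
  by_cases hxy : Γ.Adj x y
  · by_contra! hge
    have h1 := h.mul_le_of_adj hxy
    nlinarith
  · rw [h.eq_of_not_adj hm hmax hx hxy]
    norm_num

/-- If the maximal entry exceeds `t + 1` at a vertex `x` having a non-neighbor, then every
vertex whose entry is not maximal has degree at least `2 * t + 2`. -/
theorem two_mul_add_two_le_degree (h : Γ.IsValencyVector t α)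
    {m : ℤ} (hm : t = m) {x y z : V} (hmax : ∀ v, α v ≤ α x)
    (hx : t + 1 < α x) (hne : x ≠ y) (hxy : ¬ Γ.Adj x y) (hz : α z ≠ α x) :
    2 * t + 2 ≤ Γ.degree z := by
  have hy : α y = α x := h.eq_of_not_adj hm (hmax y) hx hxy
  have hadj {u : V} (hu : α u = α x) : Γ.Adj u z := by
    by_contra hn
    exact hz ((h.eq_of_not_adj hm (hu ▸ hmax z) (hu ▸ hx) hn).trans hu)
  have hax {u : V} (hu : ¬ Γ.Adj x u) : α u = α x := h.eq_of_not_adj hm (hmax u) hx hu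
  have hay {u : V} (hu : ¬ Γ.Adj y u) : α u = α x :=
    (h.eq_of_not_adj hm (hy ▸ hmax u) (hy ▸ hx) hu).trans hy
  set X := Γ.neighborFinset x
  set Y := Γ.neighborFinset y
  have hsub : {x, y} ∪ ((X \ Y) ∪ (Y \ X)) ⊆ Γ.neighborFinset z := by
    intro u hu
    rw [mem_neighborFinset, adj_comm]
    apply hadj
    simp only [Finset.mem_union, Finset.mem_insert, Finset.mem_singleton, Finset.mem_sdiff,
      mem_neighborFinset, X, Y] at hu
    rcases hu with (rfl | rfl) | ⟨-, hu⟩ | ⟨-, hu⟩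
    exacts [rfl, hy, hay hu, hax hu]
  have hdisj : Disjoint {x, y} ((X \ Y) ∪ (Y \ X)) := by
    rw [Finset.disjoint_left]
    intro u hu
    simp only [Finset.mem_insert, Finset.mem_singleton] at hu
    rcases hu with rfl | rfl
    · simp [X, Y, hxy, adj_comm Γ y]
    · simp [X, Y, hxy]
  have hdisj' : Disjoint (X \ Y) (Y \ X) := disjoint_sdiff_sdiff
  have hcard := Finset.card_le_card hsub
  rw [Finset.card_union_of_disjoint hdisj, Finset.card_union_of_disjoint hdisj',
    Finset.card_pair hne, card_neighborFinset_eq_degree] at hcard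
  have hX := Finset.card_sdiff_add_card_inter X Y
  have hY := Finset.card_sdiff_add_card_inter Y X
  rw [Finset.inter_comm] at hY
  have hc : α x * α y = (X ∩ Y).card := h.of_not_adj hne hxy
  have hdx : α x ^ 2 = X.card - t := h.sq x
  have hdy : α y ^ 2 = Y.card - t := h.sq y
  rw [hy] at hc hdy
  have hX' : ((X \ Y).card : ℝ) + (X ∩ Y).card = X.card := by exact_mod_cast hX
  have hY' : ((Y \ X).card : ℝ) + (X ∩ Y).card = Y.card := by exact_mod_cast hY
  have hcard' : (2 : ℝ) + ((X \ Y).card + (Y \ X).card) ≤ Γ.degree z := by exact_mod_cast hcard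
  nlinarith

/-- If the maximal entry exceeds `t + 1` at a vertex having a non-neighbor, then every entry is
at least two. -/
theorem two_le (h : Γ.IsValencyVector t α)
    {m : ℤ} (hm : t = m) (ht : 1 < t) {x y : V} (hmax : ∀ v, α v ≤ α x)
    (hx : t + 1 < α x) (hne : x ≠ y) (hxy : ¬ Γ.Adj x y) (z : V) : 2 ≤ α z := by
  by_contra! hz
  have h1 := h.two_mul_add_two_le_degree hm hmax hx hne hxy (z := z) (by linarith)
  have h2 := h.sq z
  have h3 : (2 : ℝ) ≤ t := by
    rw [hm] at ht ⊢
    exact_mod_cast Int.add_one_le_iff.2 (by exact_mod_cast ht : (1 : ℤ) < m)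
  nlinarith [h.pos z]

theorem le_add_one (h : Γ.IsValencyVector t α) {m : ℤ} (hm : t = m) (ht : 1 < t)
    (hnonreg : ¬ ∃ k, Γ.IsRegularOfDegree k)
    (hnotcone : ¬ ∃ v : V, Γ.degree v = Fintype.card V - 1)
    (hnotbireg : ((Finset.univ : Finset V).image (fun v => Γ.degree v)).card ≠ 2) (v : V) :
    α v ≤ t + 1 := by
  have : Nonempty V := ⟨v⟩
  obtain ⟨x, hmax⟩ := Finite.exists_max α
  refine (hmax v).trans ?_
  by_contra! hx
  obtain ⟨y, hne, hxy⟩ := Γ.exists_not_adj_of_degree_ne (not_exists.1 hnotcone x)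
  have hnear (z : V) : α x - α z < 2 :=
    h.sub_lt_two hm (hmax z) hx (h.two_le hm ht hmax hx hne hxy z)
  have hfar {z : V} (hz : α z ≠ α x) : 1 ≤ α x - α z := by
    by_contra! hlt
    refine hz (h.eq_of_abs_sub_lt_one hm (abs_sub_lt_iff.2 ⟨?_, hlt⟩))
    linarith [hmax z]
  obtain ⟨z, hz⟩ : ∃ z, α z ≠ α x := by
    by_contra! hall
    exact hnonreg ⟨Γ.degree x, fun z => h.degree_eq_iff.2 (hall z)⟩
  refine hnotbireg ?_
  rw [← Finset.card_pair fun hd => hz (h.degree_eq_iff.1 hd)]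
  congr 1
  ext d
  simp only [Finset.mem_image, Finset.mem_univ, true_and, Finset.mem_insert,
    Finset.mem_singleton]
  constructor
  · rintro ⟨w, rfl⟩
    rw [h.degree_eq_iff, h.degree_eq_iff, or_iff_not_imp_right]
    intro hw
    refine h.eq_of_abs_sub_lt_one hm (abs_sub_lt_iff.2 ⟨?_, ?_⟩) <;>
      linarith [hfar hw, hfar hz, hnear w, hnear z]
  · rintro (rfl | rfl)
    exacts [⟨z, rfl⟩, ⟨x, rfl⟩]

end IsValencyVector

end SimpleGraph

/-- For a graph in H′(s,t) (connected, nonregular, spectrum {s, 1, −t} with s > 1 > −t,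
not a cone and not biregular), every vertex x satisfies α_x = √(d_x − t) ≤ t + 1;
equivalently d_x ≤ t² + 3t + 1. -/
theorem H'_st_alpha_at_most_t_add_one
    {V : Type} [Fintype V] [DecidableEq V] (Γ : SimpleGraph V) [DecidableRel Γ.Adj]
    (s t : ℝ)
    (hconn : Γ.Connected)
    (hnonreg : ¬ ∃ k, Γ.IsRegularOfDegree k)
    (hs : 1 < s) (ht : -t < 1)
    (hspec : spectrum ℝ (Γ.adjMatrix ℝ) = {s, 1, -t})
    (hnotcone : ¬ ∃ v : V, Γ.degree v = Fintype.card V - 1)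
    (hnotbireg : ((Finset.univ : Finset V).image (fun v => Γ.degree v)).card ≠ 2) :
    ∀ x : V, Real.sqrt ((Γ.degree x : ℝ) - t) ≤ t + 1 ∧
      (Γ.degree x : ℝ) ≤ t ^ 2 + 3 * t + 1 := by
  obtain ⟨α, h⟩ := hconn.exists_isValencyVector hs ht hspec
  have ht1 := h.one_lt hconn hnonreg
  intro x
  obtain ⟨m, hm⟩ := h.exists_int_eq ht1 x (not_exists.1 hnotcone x)
  have hle := h.le_add_one hm ht1 hnonreg hnotcone hnotbireg x
  have hsq := h.sq x
  have hpos := h.pos x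
  rw [← hsq, Real.sqrt_sq hpos.le]
  exact ⟨hle, by nlinarith⟩
end

section
/- Let Γ be an n-vertex connected nonregular finite simple graph whose adjacency matrix has exactly three distinct eigenvalues s > 1 > −t, which is not a cone and not biregular. Suppose there is a squarefree natural number ω ≥ 3 such that every vertex v satisfies d_v − t = ω·β_v² for some natural number β_v. Then every vertex x with d_x = Δ(Γ) satisfies α_x := √(d_x − t) ≤ (t+3)/√3. -/
/-- A self-adjoint matrix is annihilated by every polynomial vanishing on its spectrum. -/
theorem Matrix.IsHermitian.aeval_eq_zero_of_spectrum {n : Type*} [Fintype n] [DecidableEq n]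
    {A : Matrix n n ℝ} (hA : A.IsHermitian) (q : Polynomial ℝ)
    (hq : ∀ x ∈ spectrum ℝ A, q.eval x = 0) : Polynomial.aeval A q = 0 := by
  have hA' : IsSelfAdjoint A := hA
  rw [← cfc_polynomial q A hA', cfc_congr (g := fun _ => 0) hq]
  exact cfc_const_zero ℝ A

open Matrix in
theorem Matrix.exists_mulVec_eq_smul_of_mem_spectrum {n : Type*} [Fintype n] [DecidableEq n]
    {A : Matrix n n ℝ} {s : ℝ} (hs : s ∈ spectrum ℝ A) : ∃ v ≠ 0, A *ᵥ v = s • v := by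
  have hdet : (s • (1 : Matrix n n ℝ) - A).det = 0 := by
    by_contra h
    rw [spectrum.mem_iff, Algebra.algebraMap_eq_smul_one] at hs
    exact hs ((Matrix.isUnit_iff_isUnit_det _).2 (isUnit_iff_ne_zero.2 h))
  obtain ⟨v, hv, h⟩ := Matrix.exists_mulVec_eq_zero_iff.2 hdet
  refine ⟨v, hv, ?_⟩
  rw [sub_mulVec, smul_mulVec, one_mulVec, sub_eq_zero] at h
  exact h.symm

namespace SimpleGraph

open Matrix

variable {V : Type*} [Fintype V] [DecidableEq V] {G : SimpleGraph V} [DecidableRel G.Adj]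

omit [DecidableEq V] in
/-- A nonnegative vector with `A v = s v` on a connected graph vanishes everywhere as soon as it
vanishes somewhere. -/
theorem eq_zero_of_adjMatrix_mulVec_of_nonneg (hG : G.Connected) {s : ℝ} {v : V → ℝ}
    (hv : G.adjMatrix ℝ *ᵥ v = s • v) (h0 : ∀ i, 0 ≤ v i) {i : V} (hi : v i = 0) : v = 0 := by
  funext j
  obtain ⟨p⟩ := hG.preconnected i j
  induction p with
  | nil => exact hi
  | @cons a b c hab _ ih =>
    apply ih
    have h := congrFun hv a
    rw [adjMatrix_mulVec_apply, Pi.smul_apply, hi, smul_zero] at h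
    exact (Finset.sum_eq_zero_iff_of_nonneg fun w _ => h0 w).1 h b (by simpa using hab)

/-- The coordinatewise absolute value of an eigenvector for the largest eigenvalue is again an
eigenvector. -/
theorem adjMatrix_mulVec_abs_s9 {s : ℝ} (hs : ∀ x ∈ spectrum ℝ (G.adjMatrix ℝ), x ≤ s) {v : V → ℝ}
    (hv : G.adjMatrix ℝ *ᵥ v = s • v) :
    G.adjMatrix ℝ *ᵥ (fun i => |v i|) = s • fun i => |v i| := by
  have hB : (s • (1 : Matrix V V ℝ) - G.adjMatrix ℝ).PosSemidef := by
    rw [Matrix.posSemidef_iff_isHermitian_and_spectrum_nonneg]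
    refine ⟨(isHermitian_one.smul (IsSelfAdjoint.all s)).sub (G.isHermitian_adjMatrix ℝ), ?_⟩
    rw [← Algebra.algebraMap_eq_smul_one, ← spectrum.singleton_sub_eq]
    rintro _ ⟨_, rfl, x, hx, rfl⟩
    exact sub_nonneg.2 (hs x hx)
  have hquad : ∀ u : V → ℝ, star u ⬝ᵥ ((s • (1 : Matrix V V ℝ) - G.adjMatrix ℝ) *ᵥ u)
      = s * ∑ i, u i * u i - ∑ i, ∑ j, u i * (G.adjMatrix ℝ i j * u j) := by
    intro u
    simp only [sub_mulVec, smul_mulVec, one_mulVec, dotProduct_sub, dotProduct_smul, star_trivial,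
      smul_eq_mul]
    simp only [dotProduct, mulVec, Finset.mul_sum]
  have hzero : star (fun i => |v i|) ⬝ᵥ
      ((s • (1 : Matrix V V ℝ) - G.adjMatrix ℝ) *ᵥ fun i => |v i|) = 0 := by
    refine le_antisymm ?_ (hB.dotProduct_mulVec_nonneg _)
    have h : star v ⬝ᵥ ((s • (1 : Matrix V V ℝ) - G.adjMatrix ℝ) *ᵥ v) = 0 := by
      simp [sub_mulVec, smul_mulVec, hv]
    rw [← h, hquad, hquad]
    simp only [abs_mul_abs_self]
    refine sub_le_sub_left (Finset.sum_le_sum fun i _ => Finset.sum_le_sum fun j _ => ?_) _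
    have hA : G.adjMatrix ℝ i j = |G.adjMatrix ℝ i j| := by
      rw [adjMatrix_apply]; split_ifs <;> simp
    calc v i * (G.adjMatrix ℝ i j * v j) ≤ |v i * (G.adjMatrix ℝ i j * v j)| := le_abs_self _
      _ = |v i| * (G.adjMatrix ℝ i j * |v j|) := by rw [abs_mul, abs_mul, ← hA]
  have h := (hB.dotProduct_mulVec_zero_iff _).1 hzero
  rw [sub_mulVec, smul_mulVec, one_mulVec, sub_eq_zero] at h
  exact h.symm

/-- An eigenvector for the largest eigenvalue of a connected graph vanishes nowhere. -/
theorem ne_zero_of_adjMatrix_mulVec (hG : G.Connected) {s : ℝ}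
    (hs : ∀ x ∈ spectrum ℝ (G.adjMatrix ℝ), x ≤ s) {v : V → ℝ}
    (hv : G.adjMatrix ℝ *ᵥ v = s • v) (h0 : v ≠ 0) (i : V) : v i ≠ 0 := by
  intro hi
  apply h0
  have h := eq_zero_of_adjMatrix_mulVec_of_nonneg hG (adjMatrix_mulVec_abs_s9 hs hv)
    (fun _ => abs_nonneg _) (i := i) (by simp [hi])
  funext j
  simpa using congrFun h j

/-- If the adjacency matrix of a connected graph has exactly the eigenvalues `s > 1 > -t`, then
`(A - 1)(A + t) = α αᵀ` for an entrywise positive vector `α`. -/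
theorem exists_pos_of_spectrum_eq (hG : G.Connected) {s t : ℝ} (hs : 1 < s) (ht : -t < 1)
    (hspec : spectrum ℝ (G.adjMatrix ℝ) = {s, 1, -t}) :
    ∃ α : V → ℝ, (∀ v, 0 < α v) ∧ ∀ u v, (G.adjMatrix ℝ * G.adjMatrix ℝ) u v
      + (t - 1) * G.adjMatrix ℝ u v - t * (1 : Matrix V V ℝ) u v = α u * α v := by
  set A := G.adjMatrix ℝ with hAdef
  have hmax : ∀ x ∈ spectrum ℝ A, x ≤ s := by
    rw [hspec]
    rintro x (rfl | rfl | rfl) <;> linarith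
  obtain ⟨v, hv0, hv⟩ := Matrix.exists_mulVec_eq_smul_of_mem_spectrum (A := A) (s := s)
    (by simp [hspec])
  set p : V → ℝ := fun i => |v i| with hpdef
  have hp : A *ᵥ p = s • p := adjMatrix_mulVec_abs_s9 hmax hv
  have hppos : ∀ i, 0 < p i := fun i => abs_pos.2 (ne_zero_of_adjMatrix_mulVec hG hmax hv hv0 i)
  set M : Matrix V V ℝ := A * A + (t - 1) • A - t • (1 : Matrix V V ℝ) with hM
  have hMsymm : ∀ i j, M i j = M j i := by
    have hT : Mᵀ = M := by
      simp [hM, hAdef, transpose_mul]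
    exact fun i j => congrFun (congrFun hT j) i
  have hAM : A * M = s • M := by
    have h := Matrix.IsHermitian.aeval_eq_zero_of_spectrum (A := A) (G.isHermitian_adjMatrix ℝ)
      ((Polynomial.X - Polynomial.C s) *
        (Polynomial.X * Polynomial.X + Polynomial.C (t - 1) * Polynomial.X - Polynomial.C t)) (by
        rw [hspec]
        rintro x (rfl | rfl | rfl) <;>
          simp only [Polynomial.eval_mul, Polynomial.eval_sub, Polynomial.eval_add,
            Polynomial.eval_X, Polynomial.eval_C] <;> ring)
    simp only [map_mul, map_sub, map_add, Polynomial.aeval_X, Polynomial.aeval_C,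
      Algebra.algebraMap_eq_smul_one] at h
    rw [← sub_smul, smul_mul_assoc, one_mul, ← hM, sub_mul, smul_mul_assoc, one_mul, sub_eq_zero] at h
    exact h
  obtain ⟨o⟩ := hG.nonempty
  have hcol : ∀ i j, M i j * p o = p i * M o j := by
    intro i j
    by_contra hne
    have hw : A *ᵥ (fun i => M i j * p o - p i * M o j)
        = s • fun i => M i j * p o - p i * M o j := by
      have h1 : A *ᵥ (fun i => M i j) = s • fun i => M i j := by
        funext k
        exact congrFun (congrFun hAM k) j
      have h2 : (fun i => M i j * p o - p i * M o j)
          = p o • (fun i => M i j) - M o j • p := by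
        funext k
        simp only [Pi.sub_apply, Pi.smul_apply, smul_eq_mul]
        ring
      rw [h2, mulVec_sub, mulVec_smul, mulVec_smul, h1, hp, smul_sub, smul_comm s, smul_comm s]
    refine ne_zero_of_adjMatrix_mulVec hG hmax hw (fun h => hne ?_) o ?_
    · exact sub_eq_zero.1 (congrFun h i)
    · ring
  have hMp : M *ᵥ p = ((s - 1) * (s + t)) • p := by
    simp only [hM, sub_mulVec, add_mulVec, smul_mulVec, ← mulVec_mulVec, hp, mulVec_smul,
      one_mulVec]
    module
  set γ : ℝ := M o o / (p o * p o) with hγ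
  have hMγ : ∀ i j, M i j = γ * (p i * p j) := by
    intro i j
    have h1 := hcol i j
    have h2 := hcol j o
    rw [hMsymm j o] at h2
    have := (hppos o).ne'
    rw [hγ]
    field_simp
    linear_combination p o * h1 + p i * h2
  have hγpos : 0 < γ := by
    have h := congrFun hMp o
    simp only [mulVec, dotProduct, hMγ, Pi.smul_apply, smul_eq_mul] at h
    have h1 : γ * (p o * ∑ j, p j * p j) = (s - 1) * (s + t) * p o := by
      rw [← h, Finset.mul_sum, Finset.mul_sum]
      exact Finset.sum_congr rfl fun j _ => by ring
    have h2 : 0 < (s - 1) * (s + t) * p o :=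
      mul_pos (mul_pos (by linarith) (by linarith)) (hppos o)
    have h3 : 0 ≤ p o * ∑ j, p j * p j :=
      mul_nonneg (hppos o).le (Finset.sum_nonneg fun j _ => mul_self_nonneg _)
    exact pos_of_mul_pos_left (h1 ▸ h2) h3
  refine ⟨fun i => √γ * p i, fun i => mul_pos (Real.sqrt_pos.2 hγpos) (hppos i), fun i j => ?_⟩
  have h := hMγ i j
  simp only [hM, Matrix.sub_apply, Matrix.add_apply, Matrix.smul_apply, smul_eq_mul] at h
  rw [h]
  linear_combination -(p i * p j) * Real.mul_self_sqrt hγpos.le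

theorem pos_of_spectrum_adjMatrix_eq {s t : ℝ} (hs : 1 < s)
    (hspec : spectrum ℝ (G.adjMatrix ℝ) = {s, 1, -t}) : 0 < t := by
  by_contra! h
  have hA : (G.adjMatrix ℝ).IsHermitian := (G.isHermitian_adjMatrix ℝ)
  have htr := hA.trace_eq_sum_eigenvalues
  rw [trace_adjMatrix] at htr
  have hmem : s ∈ Set.range hA.eigenvalues := by
    rw [← hA.spectrum_real_eq_range_eigenvalues, hspec]; simp
  obtain ⟨i, hi⟩ := hmem
  have hnn : ∀ j, 0 ≤ hA.eigenvalues j := by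
    intro j
    have := hA.eigenvalues_mem_spectrum_real j
    rw [hspec] at this
    rcases this with h' | h' | h' <;> rw [h'] <;> linarith
  have := Finset.single_le_sum (fun j _ => hnn j) (Finset.mem_univ i)
  simp only [RCLike.ofReal_real_eq_id, id] at htr
  linarith

omit [DecidableEq V] in
theorem degree_eq_sum_adjMatrix (v : V) : (G.degree v : ℝ) = ∑ w, G.adjMatrix ℝ v w := by
  simp [adjMatrix_apply, Finset.sum_boole, ← card_neighborFinset_eq_degree,
    neighborFinset_eq_filter]

omit [Fintype V] [DecidableEq V] in
theorem adjMatrix_nonneg (u v : V) : 0 ≤ G.adjMatrix ℝ u v := by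
  rw [adjMatrix_apply]; split_ifs <;> norm_num

omit [Fintype V] [DecidableEq V] in
theorem adjMatrix_le_one (u v : V) : G.adjMatrix ℝ u v ≤ 1 := by
  rw [adjMatrix_apply]; split_ifs <;> norm_num

omit [DecidableEq V] in
theorem adjMatrix_mul_self_apply_le_degree (u v : V) :
    (G.adjMatrix ℝ * G.adjMatrix ℝ) u v ≤ G.degree v := by
  rw [Matrix.mul_apply, degree_eq_sum_adjMatrix]
  refine Finset.sum_le_sum fun w _ => ?_
  rw [G.isSymm_adjMatrix.apply v w]
  exact mul_le_of_le_one_left (adjMatrix_nonneg _ _) (adjMatrix_le_one _ _)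

theorem degree_eq_mul_self_add {t : ℝ} {α : V → ℝ}
    (h : ∀ u v, (G.adjMatrix ℝ * G.adjMatrix ℝ) u v
      + (t - 1) * G.adjMatrix ℝ u v - t * (1 : Matrix V V ℝ) u v = α u * α v) (v : V) :
    (G.degree v : ℝ) = α v * α v + t := by
  have := h v v
  rw [adjMatrix_mul_self_apply_self, adjMatrix_apply, one_apply_eq] at this
  simp only [SimpleGraph.irrefl, if_false] at this
  linarith

/-- Suppose `(A - 1)(A + t) = α αᵀ` with `α` positive. If the graph is neither a cone, nor regular,
nor biregular, then some vertex of maximum degree has a nonneighbour of smaller degree. -/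
theorem exists_not_adj_of_degree_lt [Nonempty V] {t : ℝ} (ht : 0 < t) {α : V → ℝ}
    (hα : ∀ v, 0 < α v)
    (h : ∀ u v, (G.adjMatrix ℝ * G.adjMatrix ℝ) u v
      + (t - 1) * G.adjMatrix ℝ u v - t * (1 : Matrix V V ℝ) u v = α u * α v)
    (hnonreg : ¬ ∃ k, G.IsRegularOfDegree k)
    (hnotcone : ¬ ∃ v : V, G.degree v = Fintype.card V - 1)
    (hnotbireg : ((Finset.univ : Finset V).image (fun v => G.degree v)).card ≠ 2) :
    ∃ x y, G.degree x = G.maxDegree ∧ G.degree y < G.maxDegree ∧ ¬ G.Adj x y := by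
  by_contra! hjoin
  have hdiag := degree_eq_mul_self_add h
  obtain ⟨x, hx⟩ := G.exists_maximal_degree_vertex
  have hlt : ∀ v, G.degree v ≠ G.maxDegree → G.degree v < G.maxDegree := fun v hv =>
    lt_of_le_of_ne (G.degree_le_maxDegree v) hv
  obtain ⟨y, hy⟩ : ∃ y, G.degree y ≠ G.maxDegree := by
    by_contra! hall
    exact hnonreg ⟨_, hall⟩
  obtain ⟨y', hy', hyy'⟩ : ∃ y', G.degree y' ≠ G.maxDegree ∧ G.degree y' ≠ G.degree y := by
    by_contra! hall
    apply hnotbireg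
    have : (Finset.univ : Finset V).image (fun v => G.degree v)
        = {G.maxDegree, G.degree y} := by
      ext d
      simp only [Finset.mem_image, Finset.mem_univ, true_and, Finset.mem_insert,
        Finset.mem_singleton]
      constructor
      · rintro ⟨v, rfl⟩
        exact or_iff_not_imp_left.2 (hall v)
      · rintro (rfl | rfl)
        exacts [⟨x, hx.symm⟩, ⟨y, rfl⟩]
    rw [this, Finset.card_pair hy.symm]
  set X : Finset V := Finset.univ.filter fun v => G.degree v = G.maxDegree with hX
  have hmemX : ∀ v, v ∈ X ↔ G.degree v = G.maxDegree := by simp [hX]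
  have hxX : x ∈ X := (hmemX x).2 hx.symm
  have hαX : ∀ v ∈ X, α v = α x := by
    intro v hv
    have h1 := hdiag v
    have h2 := hdiag x
    rw [(hmemX v).1 hv, hx] at h1
    exact (mul_self_inj (hα v).le (hα x).le).1 (by linarith)
  have hadj : ∀ u ∈ X, ∀ v ∈ Xᶜ, G.adjMatrix ℝ u v = 1 := by
    intro u hu v hv
    rw [Finset.mem_compl, hmemX] at hv
    rw [adjMatrix_apply, if_pos (hjoin u v ((hmemX u).1 hu) (hlt v hv))]
  have hadj' : ∀ u ∈ X, ∀ v ∈ Xᶜ, G.adjMatrix ℝ v u = 1 := fun u hu v hv => by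
    rw [G.isSymm_adjMatrix.apply u v, hadj u hu v hv]
  set k : ℝ := (G.maxDegree : ℝ) - Xᶜ.card with hk
  have hsumX : ∀ u ∈ X, ∑ w ∈ X, G.adjMatrix ℝ u w = k := by
    intro u hu
    have h1 := degree_eq_sum_adjMatrix (G := G) u
    rw [← Finset.sum_add_sum_compl X, Finset.sum_congr rfl (hadj u hu), (hmemX u).1 hu] at h1
    simp only [Finset.sum_const, nsmul_eq_mul, mul_one] at h1
    linarith
  have hsumY : ∀ v ∈ Xᶜ, ∑ w ∈ X, G.adjMatrix ℝ v w = X.card := by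
    intro v hv
    rw [Finset.sum_congr rfl fun w hw => hadj' w hw v hv]
    simp
  have hquad : ∀ v ∈ Xᶜ, α v * α v - α x * α v + (k + 2 * t - 1 - X.card) = 0 := by
    intro v hv
    have h1 := h x v
    have hne : x ≠ v := fun e => (Finset.mem_compl.1 hv) (e ▸ hxX)
    rw [one_apply_ne hne, hadj x hxX v hv, Matrix.mul_apply, ← Finset.sum_add_sum_compl X,
      Finset.sum_congr rfl fun w hw => by rw [hadj w hw v hv, mul_one], hsumX x hxX,
      Finset.sum_congr rfl fun w hw => by
        rw [hadj x hxX w hw, one_mul, G.isSymm_adjMatrix.apply v w]] at h1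
    have h2 := degree_eq_sum_adjMatrix (G := G) v
    rw [← Finset.sum_add_sum_compl X, hsumY v hv] at h2
    have h3 := hdiag v
    linarith
  have hprod : α y * α y' = k + 2 * t - 1 - X.card := by
    have h1 := hquad y (by rwa [Finset.mem_compl, hmemX])
    have h2 := hquad y' (by rwa [Finset.mem_compl, hmemX])
    have hne : α y' - α y ≠ 0 := by
      intro e
      apply hyy'
      have h3 := hdiag y
      have h4 := hdiag y'
      rw [sub_eq_zero.1 e, ← h3] at h4
      exact_mod_cast h4
    refine mul_left_cancel₀ hne ?_
    linear_combination α y * h2 - α y' * h1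
  have hcount : (k - 1) * (k + t) = (k - t) * X.card := by
    have h1 : ∑ v ∈ X, ((G.adjMatrix ℝ * G.adjMatrix ℝ) x v
        + (t - 1) * G.adjMatrix ℝ x v - t * (1 : Matrix V V ℝ) x v) = ∑ v ∈ X, α x * α x :=
      Finset.sum_congr rfl fun v hv => by rw [h x v, hαX v hv]
    have h2 : ∑ v ∈ X, (G.adjMatrix ℝ * G.adjMatrix ℝ) x v = k * k + Xᶜ.card * X.card := by
      simp only [Matrix.mul_apply]
      rw [Finset.sum_comm]
      simp only [← Finset.mul_sum]
      rw [← Finset.sum_add_sum_compl X,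
        Finset.sum_congr rfl fun w hw => by rw [hsumX w hw],
        Finset.sum_congr (s₁ := Xᶜ) rfl fun w hw => by rw [hsumY w hw, hadj x hxX w hw, one_mul],
        ← Finset.sum_mul, hsumX x hxX]
      simp
    have h3 : ∑ v ∈ X, (1 : Matrix V V ℝ) x v = 1 := by
      simp [one_apply, hxX]
    rw [Finset.sum_sub_distrib, Finset.sum_add_distrib, ← Finset.mul_sum, ← Finset.mul_sum, h2, h3,
      hsumX x hxX, Finset.sum_const, nsmul_eq_mul] at h1
    have h4 := hdiag x
    rw [← hx] at h4
    have h5 : α x * α x = k + Xᶜ.card - t := by rw [hk]; linarith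
    rw [h5] at h1
    linear_combination h1
  have hk0 : 0 ≤ k := by
    rw [← hsumX x hxX]
    exact Finset.sum_nonneg fun _ _ => adjMatrix_nonneg _ _
  have hkX : k + 2 ≤ X.card := by
    obtain ⟨z, hzx, hz⟩ : ∃ z, z ≠ x ∧ ¬ G.Adj x z := by
      by_contra! hall
      refine hnotcone ⟨x, ?_⟩
      rw [← card_neighborFinset_eq_degree, ← Finset.card_univ,
        ← Finset.card_erase_of_mem (Finset.mem_univ x)]
      congr 1
      ext z
      simp only [mem_neighborFinset, Finset.mem_erase, Finset.mem_univ, and_true]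
      exact ⟨fun e => e.ne', hall z⟩
    have hzX : z ∈ X := by
      by_contra hzX
      exact hz (hjoin x z hx.symm (hlt z (by rwa [hmemX] at hzX)))
    have hle : ∑ w ∈ X, (G.adjMatrix ℝ x w + (1 : Matrix V V ℝ) x w + (1 : Matrix V V ℝ) z w)
        ≤ ∑ _w ∈ X, (1 : ℝ) := by
      refine Finset.sum_le_sum fun w _ => ?_
      by_cases h1 : w = x
      · subst h1; simp [one_apply, hzx]
      · by_cases h2 : w = z
        · subst h2; simp [one_apply, hz, hzx.symm]
        · rw [one_apply_ne (Ne.symm h1), one_apply_ne (Ne.symm h2)]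
          simpa using adjMatrix_le_one x w
    rw [Finset.sum_add_distrib, Finset.sum_add_distrib, hsumX x hxX] at hle
    simp only [one_apply, Finset.sum_ite_eq, if_pos hxX, if_pos hzX, Finset.sum_const,
      nsmul_eq_mul, mul_one] at hle
    linarith
  have hpos := mul_pos (hα y) (hα y')
  rw [hprod] at hpos
  have h1 : 0 ≤ k * (k + 2 * t - 1 - X.card) := mul_nonneg hk0 hpos.le
  have h2 : 0 < t * (X.card - k - 1) := mul_pos ht (by linarith)
  linarith

end SimpleGraph

/-- If `1 ≤ a ≤ b - 1` and `3 ≤ ω`, then `(√ω a) (√ω b - √ω a) ≤ t` bounds `√ω b`. -/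
theorem sqrt_mul_le_of_mul_mul_sub_le {ω a b t : ℝ} (hω : 3 ≤ ω) (ha : 1 ≤ a) (hab : a + 1 ≤ b)
    (h : ω * (a * (b - a)) ≤ t) : √ω * b ≤ (t + 3) / √3 := by
  have h3 : 0 < √(3 : ℝ) := by positivity
  rw [le_div_iff₀ h3]
  have hw : √3 ≤ √ω := Real.sqrt_le_sqrt hω
  have hs3 : √(3 : ℝ) * √3 = 3 := Real.mul_self_sqrt (by norm_num)
  have hsω : √ω * √ω = ω := Real.mul_self_sqrt (by linarith)
  have h1 : b - 1 ≤ a * (b - a) := by nlinarith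
  have h2 : ω * (b - 1) ≤ t := (mul_le_mul_of_nonneg_left h1 (by linarith)).trans h
  have h4 : 0 ≤ (b - 2) * (√ω * (√ω - √3)) :=
    mul_nonneg (by linarith) (mul_nonneg (Real.sqrt_nonneg _) (by linarith))
  nlinarith [sq_nonneg (√ω - √3)]

/-- For a graph in H′(s,t) with squarefree part ω(Γ) ≥ 3, every vertex x of maximum
degree satisfies α_x = √(d_x − t) ≤ (t+3)/√3. -/
theorem H'_st_omega_ge_three_alpha_bound
    {V : Type} [Fintype V] [DecidableEq V] (Γ : SimpleGraph V) [DecidableRel Γ.Adj]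
    (s t : ℝ)
    (hconn : Γ.Connected)
    (hnonreg : ¬ ∃ k, Γ.IsRegularOfDegree k)
    (hs : 1 < s) (ht : -t < 1)
    (hspec : spectrum ℝ (Γ.adjMatrix ℝ) = {s, 1, -t})
    (hnotcone : ¬ ∃ v : V, Γ.degree v = Fintype.card V - 1)
    (hnotbireg : ((Finset.univ : Finset V).image (fun v => Γ.degree v)).card ≠ 2)
    (ω : ℕ) (hωsf : Squarefree ω) (hω3 : 3 ≤ ω)
    (hω : ∀ v : V, ∃ β : ℕ, (Γ.degree v : ℝ) - t = (ω : ℝ) * (β : ℝ) ^ 2) :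
    ∀ x : V, Γ.degree x = Γ.maxDegree →
      Real.sqrt ((Γ.degree x : ℝ) - t) ≤ (t + 3) / Real.sqrt 3 := by
  intro x hx
  have := hconn.nonempty
  have htpos := SimpleGraph.pos_of_spectrum_adjMatrix_eq hs hspec
  obtain ⟨α, hα, h⟩ := SimpleGraph.exists_pos_of_spectrum_eq hconn hs ht hspec
  obtain ⟨x', y, hx', hy, hadj⟩ :=
    SimpleGraph.exists_not_adj_of_degree_lt htpos hα h hnonreg hnotcone hnotbireg
  have hdiag : ∀ v, (Γ.degree v : ℝ) - t = α v * α v := fun v => by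
    linarith [SimpleGraph.degree_eq_mul_self_add h v]
  have hω0 : (3 : ℝ) ≤ ω := by exact_mod_cast hω3
  have hβ : ∀ v (β : ℕ), (Γ.degree v : ℝ) - t = (ω : ℝ) * (β : ℝ) ^ 2 → α v = √ω * β := by
    intro v β hv
    have h1 : √(ω : ℝ) * √ω = ω := Real.mul_self_sqrt (by linarith)
    refine (mul_self_inj (hα v).le (by positivity)).1 ?_
    rw [← hdiag, hv]
    linear_combination -(β : ℝ) ^ 2 * h1
  obtain ⟨b, hb⟩ := hω x'
  obtain ⟨a, ha⟩ := hω y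
  have hαb := hβ x' b hb
  have hαa := hβ y a ha
  have ha1 : 1 ≤ a := by
    rw [Nat.one_le_iff_ne_zero]
    rintro rfl
    have := hα y
    simp [hαa] at this
  have hab : a + 1 ≤ b := by
    have h1 : (Γ.degree y : ℝ) < Γ.degree x' := by rw [hx']; exact_mod_cast hy
    have h2 : (a : ℝ) ^ 2 < (b : ℝ) ^ 2 := lt_of_mul_lt_mul_left (a := (ω : ℝ)) (by linarith)
      (by linarith)
    exact_mod_cast lt_of_pow_lt_pow_left₀ 2 (by positivity) h2
  have hne : x' ≠ y := by
    rintro rfl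
    omega
  have hle := SimpleGraph.adjMatrix_mul_self_apply_le_degree (G := Γ) x' y
  have hxy := h x' y
  rw [SimpleGraph.adjMatrix_apply, if_neg hadj, Matrix.one_apply_ne hne] at hxy
  rw [hx, ← hx', hdiag, Real.sqrt_mul_self (hα x').le, hαb]
  refine sqrt_mul_le_of_mul_mul_sub_le (a := a) hω0 (by exact_mod_cast ha1) (by exact_mod_cast hab) ?_
  have h1 : √(ω : ℝ) * √ω = ω := Real.mul_self_sqrt (by linarith)
  rw [hαb, hαa] at hxy
  linear_combination hle - hxy + ha - (a : ℝ) * b * h1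
end
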